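/- Let b ≥ 2 be an integer base, let i ∈ I, and let n ≥ 2. Then b^{B(n)} < K(n) ≤ K_i(n) < β·b^{B(n)+1}, where β := 1 if b is even and β := 1/2 if b is odd. -/

import Mathlib

namespace Kaprekar

/-- Sum of the digits of `v` in base `b`. -/
def s (b v : ℕ) : ℕ := (Nat.digits b v).sum

/-- `f v = v + s v`. -/
def f (b v : ℕ) : ℕ := v + s b v

/-- `F u` is the number of generators of `u`. -/
noncomputable def F (b u : ℕ) : ℕ := Set.ncard {v : ℕ | f b v = u}

/-- `K n` is the least `u` with exactly `n` generators. -/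
noncomputable def K (b n : ℕ) : ℕ := sInf {u : ℕ | F b u = n}

/-- `B n = ⌊log_b K(n)⌋`. -/
noncomputable def B (b n : ℕ) : ℕ := Nat.log b (K b n)

/-- `Ki i n` is the least `u ≡ i (mod b-1)` with exactly `n` generators. -/
noncomputable def Ki (b : ℕ) (i : ZMod (b - 1)) (n : ℕ) : ℕ :=
  sInf {u : ℕ | F b u = n ∧ (u : ZMod (b - 1)) = i}

/-- The index set `I`: all residues mod `b-1` if `b` is even, the even residues if `b` is odd. -/
def I (b : ℕ) : Set (ZMod (b - 1)) := {i | Even b ∨ ∃ j : ZMod (b - 1), i = 2 * j}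

theorem s_eq_mod_add {b : ℕ} (hb : 2 ≤ b) (n : ℕ) : s b n = n % b + s b (n / b) := by
  rcases Nat.eq_zero_or_pos n with rfl | h
  · simp [s]
  · unfold s
    rw [Nat.digits_def' (by omega) h, List.sum_cons]

theorem s_of_lt {b v : ℕ} (hb : 2 ≤ b) (hv : v < b) : s b v = v := by
  rw [s_eq_mod_add hb, Nat.div_eq_of_lt hv, Nat.mod_eq_of_lt hv]
  simp [s]

theorem s_mul_add {b c : ℕ} (hb : 2 ≤ b) (hc : c < b) (a : ℕ) : s b (a * b + c) = s b a + c := by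
  have h1 : (a * b + c) % b = c := by
    rw [mul_comm, Nat.mul_add_mod, Nat.mod_eq_of_lt hc]
  have h2 : (a * b + c) / b = a := by
    rw [mul_comm, Nat.mul_add_div (by omega), Nat.div_eq_of_lt hc, add_zero]
  rw [s_eq_mod_add hb, h1, h2, add_comm]

theorem s_mul_pow_add {b : ℕ} (hb : 2 ≤ b) (d : ℕ) (m : ℕ) :
    ∀ w < b ^ m, s b (d * b ^ m + w) = s b d + s b w := by
  induction m with
  | zero =>
    intro w hw
    obtain rfl : w = 0 := by simpa using hw
    simp [s]
  | succ m ih =>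
    intro w hw
    have hc : w % b < b := Nat.mod_lt _ (by omega)
    have hq : w / b < b ^ m := Nat.div_lt_of_lt_mul (by rwa [pow_succ, mul_comm] at hw)
    have h1 : d * b ^ (m + 1) + w = (d * b ^ m + w / b) * b + w % b := by
      conv_lhs => rw [← Nat.div_add_mod w b]
      ring
    rw [h1, s_mul_add hb hc, ih _ hq, s_eq_mod_add hb w]
    ring

theorem s_add_s_of_complement {b : ℕ} (hb : 2 ≤ b) (m : ℕ) :
    ∀ x w, x + w + 1 = b ^ m → s b x + s b w = m * (b - 1) := by
  induction m with
  | zero =>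
    intro x w h
    obtain ⟨rfl, rfl⟩ : x = 0 ∧ w = 0 := by simp at h; omega
    simp [s]
  | succ m ih =>
    intro x w h
    have hx : x % b < b := Nat.mod_lt _ (by omega)
    have hw : w % b < b := Nat.mod_lt _ (by omega)
    have h1 : b * (x / b + w / b) + (x % b + w % b + 1) = b * b ^ m := by
      have := Nat.div_add_mod x b
      have := Nat.div_add_mod w b
      rw [pow_succ] at h
      linarith
    have hdvd : b ∣ x % b + w % b + 1 :=
      (Nat.dvd_add_right (Dvd.intro _ rfl)).1 (h1 ▸ Dvd.intro _ rfl)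
    obtain ⟨k, hk⟩ := hdvd
    have hk1 : k = 1 := by
      have : k < 2 := by
        by_contra hcon
        have : b * 2 ≤ b * k := Nat.mul_le_mul_left b (by omega)
        omega
      interval_cases k <;> omega
    subst hk1
    have h2 : x / b + w / b + 1 = b ^ m := by
      have : b * (x / b + w / b + 1) = b * b ^ m := by rw [← h1, hk]; ring
      exact Nat.eq_of_mul_eq_mul_left (by omega) this
    have := ih _ _ h2
    rw [s_eq_mod_add hb x, s_eq_mod_add hb w, add_mul]
    omega

theorem s_le {b m v : ℕ} (hb : 2 ≤ b) (hv : v < b ^ m) : s b v ≤ m * (b - 1) := by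
  have := s_add_s_of_complement hb m (b ^ m - 1 - v) v (by omega)
  omega

theorem finite_generators (b u : ℕ) : {v : ℕ | f b v = u}.Finite :=
  (Set.finite_Iic u).subset fun v hv => by
    simp only [Set.mem_ofPred_eq, f] at hv
    simp only [Set.mem_Iic]
    omega

theorem succ_mul_lt_pow {b m : ℕ} (hb : 2 ≤ b) (hm : 2 ≤ m) : (m + 1) * (b - 1) < b ^ m := by
  obtain ⟨c, rfl⟩ : ∃ c, b = c + 2 := ⟨b - 2, by omega⟩
  induction m, hm using Nat.le_induction with
  | base => simp; nlinarith
  | succ m hm ih =>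
    rw [pow_succ]
    simp only [Nat.add_succ_sub_one] at ih ⊢
    nlinarith [Nat.zero_le c, Nat.zero_le (m * c)]

/-- The generators of `d * b ^ m + t` split into those with leading digit `d` and those with
leading digit `d - 1`. -/
theorem F_mul_pow_add {b m d t : ℕ} (hb : 2 ≤ b) (hm : 2 ≤ m) (hd : 1 ≤ d) (hdb : d < b)
    (ht : t < b ^ m) :
    F b (d * b ^ m + t) =
      {w : ℕ | f b w + d = t}.ncard + {x : ℕ | f b x + t + 2 = m * (b - 1) + d}.ncard := by
  have hlt := succ_mul_lt_pow hb hm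
  rw [add_mul] at hlt
  obtain ⟨e, rfl⟩ : ∃ e, d = e + 1 := ⟨d - 1, by omega⟩
  have hsd : s b (e + 1) = e + 1 := s_of_lt hb hdb
  have hse : s b e = e := s_of_lt hb (by omega)
  set N := b ^ m with hN
  set A := {w : ℕ | f b w + (e + 1) = t} with hA
  set C := {x : ℕ | f b x + t + 2 = m * (b - 1) + (e + 1)} with hC
  have hAlt : ∀ w ∈ A, w < N := by
    intro w hw
    simp only [hA, Set.mem_ofPred_eq, f] at hw
    omega
  have hClt : ∀ x ∈ C, x < N := by
    intro x hx
    simp only [hC, Set.mem_ofPred_eq, f] at hx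
    omega
  have hset : {v : ℕ | f b v = (e + 1) * N + t} =
      (fun w => (e + 1) * N + w) '' A ∪ (fun x => (e + 1) * N - 1 - x) '' C := by
    ext v
    simp only [Set.mem_union, Set.mem_image, Set.mem_ofPred_eq]
    constructor
    · intro hv
      by_cases h1 : (e + 1) * N ≤ v
      · left
        obtain ⟨w, rfl⟩ := Nat.exists_eq_add_of_le h1
        have hw : w < N := by unfold f at hv; omega
        refine ⟨w, ?_, rfl⟩
        have := s_mul_pow_add hb (e + 1) m w hw
        simp only [hA, Set.mem_ofPred_eq]
        unfold f at hv ⊢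
        rw [this, hsd] at hv
        omega
      · right
        rw [add_mul] at h1 hv
        have h2 : e * N ≤ v := by
          by_contra h2
          obtain ⟨g, rfl⟩ : ∃ g, e = g + 1 := by
            rcases e with _ | g
            · simp at h2
            · exact ⟨g, rfl⟩
          have hdm := Nat.div_add_mod v N
          have hml : v % N < N := Nat.mod_lt _ (by omega)
          have hdl : v / N < g + 1 := Nat.div_lt_of_lt_mul (by rw [mul_comm]; omega)
          have h3 := s_mul_pow_add hb (v / N) m (v % N) hml
          rw [← hN, mul_comm, hdm, s_of_lt hb (by omega : v / N < b)] at h3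
          have h4 := s_le hb hml
          unfold f at hv
          omega
        obtain ⟨w, rfl⟩ := Nat.exists_eq_add_of_le h2
        have hw : w < N := by omega
        refine ⟨N - 1 - w, ?_, by rw [add_mul]; omega⟩
        have h3 := s_mul_pow_add hb e m w hw
        have h4 := s_add_s_of_complement hb m (N - 1 - w) w (by omega)
        simp only [hC, Set.mem_ofPred_eq]
        unfold f at hv ⊢
        rw [h3, hse] at hv
        omega
    · rintro (⟨w, hw, rfl⟩ | ⟨x, hx, rfl⟩)
      · have := s_mul_pow_add hb (e + 1) m w (hAlt w hw)
        simp only [hA, Set.mem_ofPred_eq] at hw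
        unfold f at hw ⊢
        rw [this, hsd]
        omega
      · have hxl := hClt x hx
        have h1 : (e + 1) * N - 1 - x = e * N + (N - 1 - x) := by rw [add_mul]; omega
        have h3 := s_mul_pow_add hb e m (N - 1 - x) (by omega)
        have h4 := s_add_s_of_complement hb m (N - 1 - x) x (by omega)
        simp only [hC, Set.mem_ofPred_eq] at hx
        unfold f at hx ⊢
        rw [h1, h3, hse, add_mul]
        omega
  have hAfin : A.Finite := (Set.finite_Iio N).subset hAlt
  have hCfin : C.Finite := (Set.finite_Iio N).subset hClt
  unfold F
  rw [hset, Set.ncard_union_eq _ (hAfin.image _) (hCfin.image _), Set.ncard_image_of_injective,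
    Set.InjOn.ncard_image]
  · intro x hx y hy hxy
    have h1 := hClt x hx
    have h2 := hClt y hy
    simp only [add_mul] at hxy
    omega
  · intro x y hxy
    simpa using hxy
  · rw [Set.disjoint_left]
    rintro _ ⟨w, -, rfl⟩ ⟨x, hx, hxy⟩
    have h1 := hClt x hx
    simp only [add_mul] at hxy
    omega

theorem F_mul_pow_add_add {b m d p q : ℕ} (hb : 2 ≤ b) (hm : 2 ≤ m) (hd : 1 ≤ d) (hdb : d < b)
    (hpq : p + q + 2 = m * (b - 1)) : F b (d * b ^ m + (d + p)) = F b p + F b q := by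
  have hlt := succ_mul_lt_pow hb hm
  rw [add_mul] at hlt
  rw [F_mul_pow_add hb hm hd hdb (by omega)]
  unfold F
  congr 2 <;> ext v <;> simp only [Set.mem_ofPred_eq] <;> omega

theorem F_zero (b : ℕ) : F b 0 = 1 := by
  have : {v : ℕ | f b v = 0} = {0} := by
    ext v
    simp only [Set.mem_ofPred_eq, Set.mem_singleton_iff, f]
    constructor
    · omega
    · rintro rfl
      simp [s]
  rw [F, this, Set.ncard_singleton]

theorem f_mul_add {b a c : ℕ} (hb : 2 ≤ b) (ha : a < b) (hc : c < b) :
    f b (a * b + c) = a * b + a + 2 * c := by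
  rw [f, s_mul_add hb hc, s_of_lt hb ha]
  ring

theorem eq_of_f_eq_of_lt {b v v' : ℕ} (hb : 2 ≤ b) (hv : v' < b ^ 2) (hlt : v < v')
    (h : f b v = f b v') : Odd b ∧ v' = v + (b - 1) / 2 ∧ b < f b v' := by
  have hc : v % b < b := Nat.mod_lt _ (by omega)
  have hc' : v' % b < b := Nat.mod_lt _ (by omega)
  have ha : v / b < b := Nat.div_lt_of_lt_mul (by rw [← sq]; omega)
  have ha' : v' / b < b := Nat.div_lt_of_lt_mul (by rw [← sq]; omega)
  rw [← Nat.div_add_mod' v b] at h hlt ⊢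
  rw [← Nat.div_add_mod' v' b] at h hlt ⊢
  generalize v / b = a at *
  generalize v % b = c at *
  generalize v' / b = a' at *
  generalize v' % b = c' at *
  rw [f_mul_add hb ha hc, f_mul_add hb ha' hc'] at *
  obtain ⟨k, rfl⟩ : ∃ k, a' = a + k := by
    refine Nat.exists_eq_add_of_le ?_
    by_contra hcon
    obtain ⟨k, rfl⟩ := Nat.exists_eq_add_of_lt (not_le.1 hcon)
    nlinarith
  have hk : k < 2 := by
    by_contra hcon
    nlinarith
  interval_cases k
  · simp at h hlt
    omega
  · simp only [add_mul, one_mul] at *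
    refine ⟨⟨b / 2, by omega⟩, by omega, by omega⟩

theorem F_le_two {b u : ℕ} (hb : 2 ≤ b) (hu : u < b ^ 2) : F b u ≤ 2 := by
  rcases Set.eq_empty_or_nonempty {v : ℕ | f b v = u} with h | h
  · rw [F, h]; simp
  · have hsub : {v : ℕ | f b v = u} ⊆
        {sInf {v : ℕ | f b v = u}, sInf {v : ℕ | f b v = u} + (b - 1) / 2} := by
      intro v hv
      have h0 := Nat.sInf_mem h
      have hle := Nat.sInf_le hv
      simp only [Set.mem_insert_iff, Set.mem_singleton_iff]
      rcases hle.eq_or_lt with h1 | h1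
      · exact Or.inl h1.symm
      · have hvu : f b v = u := hv
        exact Or.inr (eq_of_f_eq_of_lt hb (by unfold f at hvu; omega) h1 (h0.trans hv.symm)).2.1
    refine (Set.ncard_le_ncard hsub (by simp)).trans ((Set.ncard_insert_le _ _).trans ?_)
    rw [Set.ncard_singleton]

theorem F_mul_succ {b d : ℕ} (hb : 2 ≤ b) (hodd : Odd b) (hd : 1 ≤ d) (hdb : 2 * d ≤ b - 1) :
    F b (d * (b + 1)) = 2 := by
  obtain ⟨k, rfl⟩ := hodd
  refine le_antisymm (F_le_two hb (by nlinarith [show d ≤ k by omega])) ?_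
  obtain ⟨e, rfl⟩ : ∃ e, d = e + 1 := ⟨d - 1, by omega⟩
  have h1 := f_mul_add (a := e + 1) (c := 0) hb (by omega) (by omega)
  have h2 := f_mul_add (a := e) (c := k + 1) hb (by omega) (by omega)
  refine (Set.one_lt_ncard_iff (finite_generators _ _)).2
    ⟨(e + 1) * (2 * k + 1) + 0, e * (2 * k + 1) + (k + 1), ?_, ?_, ?_⟩
  · simp only [Set.mem_ofPred_eq, h1]; ring
  · simp only [Set.mem_ofPred_eq, h2]; ring
  · rw [add_mul]
    omega

theorem natCast_base {b : ℕ} (hb : 2 ≤ b) : (b : ZMod (b - 1)) = 1 := by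
  have h : ((b - 1 : ℕ) : ZMod (b - 1)) = 0 := ZMod.natCast_self _
  rw [Nat.cast_sub (by omega), Nat.cast_one] at h
  exact sub_eq_zero.1 h

theorem natCast_s {b : ℕ} (hb : 2 ≤ b) (v : ℕ) : (s b v : ZMod (b - 1)) = v := by
  induction v using Nat.strong_induction_on with
  | _ v ih =>
    rcases Nat.eq_zero_or_pos v with rfl | h
    · simp [s]
    · rw [s_eq_mod_add hb, Nat.cast_add, ih _ (Nat.div_lt_self h (by omega))]
      conv_rhs => rw [← Nat.mod_add_div v b]
      rw [Nat.cast_add, Nat.cast_mul, natCast_base hb, one_mul]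

theorem natCast_f {b : ℕ} (hb : 2 ≤ b) (v : ℕ) : (f b v : ZMod (b - 1)) = 2 * v := by
  rw [f, Nat.cast_add, natCast_s hb, two_mul]

theorem exists_eq_two_mul_of_mem_I {b : ℕ} (hb : 2 ≤ b) {i : ZMod (b - 1)} (hi : i ∈ I b) :
    ∃ j, i = 2 * j := by
  rcases hi with ⟨k, hk⟩ | h
  · refine ⟨k * i, ?_⟩
    have h1 := natCast_base hb
    have h2 : (b : ZMod (b - 1)) = k + k := by
      rw [← Nat.cast_add]
      exact congrArg _ hk
    rw [← mul_assoc, two_mul, ← h2, h1, one_mul]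
  · exact h

theorem exists_digit_two_mul_eq {b : ℕ} (hb : 2 ≤ b) (e : ZMod (b - 1)) :
    ∃ d : ℕ, 1 ≤ d ∧ d < b ∧ (Odd b → 2 * d ≤ b - 1) ∧ (2 * d : ZMod (b - 1)) = 2 * e := by
  have : NeZero (b - 1) := ⟨by omega⟩
  have he : ((e.val : ℕ) : ZMod (b - 1)) = e := ZMod.natCast_zmod_val e
  have hel : e.val < b - 1 := ZMod.val_lt e
  have h0 : ((b - 1 : ℕ) : ZMod (b - 1)) = 0 := ZMod.natCast_self _
  rcases Nat.even_or_odd b with hev | hodd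
  · have hno : ¬ Odd b := Nat.not_odd_iff_even.2 hev
    by_cases h : e.val = 0
    · refine ⟨b - 1, by omega, by omega, fun h => absurd h hno, ?_⟩
      rw [h0, ← he, h, Nat.cast_zero]
    · exact ⟨e.val, by omega, by omega, fun h => absurd h hno, by rw [he]⟩
  · have hb2 : 2 * ((b - 1) / 2) = b - 1 := by
      obtain ⟨k, rfl⟩ := hodd
      omega
    have h2 : (2 * ((b - 1) / 2 : ℕ) : ZMod (b - 1)) = 0 := by
      rw [← h0, ← hb2]; push_cast; simp
    by_cases h : e.val = 0
    · refine ⟨(b - 1) / 2, by omega, by omega, fun _ => by omega, ?_⟩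
      rw [h2, ← he, h]; simp
    · by_cases h3 : e.val ≤ (b - 1) / 2
      · exact ⟨e.val, by omega, by omega, fun _ => by omega, by rw [he]⟩
      · refine ⟨e.val - (b - 1) / 2, by omega, by omega, fun _ => by omega, ?_⟩
        rw [Nat.cast_sub (by omega), he, mul_sub, h2, sub_zero]

theorem exists_small_of_split {b m p q : ℕ} (hb : 2 ≤ b) (hm : 2 ≤ m)
    (hpq : p + q + 2 = m * (b - 1)) (hle : p ≤ q) (j y : ZMod (b - 1))
    (hp : (p : ZMod (b - 1)) = 2 * y) :
    ∃ u : ℕ, F b u = F b p + F b q ∧ (u : ZMod (b - 1)) = 2 * j ∧ u < b ^ (m + 1) ∧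
      (Odd b → 2 * u < b ^ (m + 1)) := by
  obtain ⟨d, hd1, hdb, hdo, hde⟩ := exists_digit_two_mul_eq hb (j - y)
  have hlt := succ_mul_lt_pow hb hm
  rw [add_mul] at hlt
  refine ⟨d * b ^ m + (d + p), F_mul_pow_add_add hb hm hd1 hdb hpq, ?_, ?_, fun ho => ?_⟩
  · push_cast
    rw [natCast_base hb, hp]
    linear_combination hde
  · have : (d + 1) * b ^ m ≤ b * b ^ m := Nat.mul_le_mul_right _ (by omega)
    rw [pow_succ, mul_comm (b ^ m)]
    rw [add_mul] at this
    omega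
  · have h1 := hdo ho
    have : (2 * d + 1) * b ^ m ≤ b * b ^ m := Nat.mul_le_mul_right _ (by omega)
    rw [pow_succ, mul_comm (b ^ m)]
    rw [add_mul, mul_assoc] at this
    omega

/-- A number with at least two generators that is minimal for its number of generators is not a
power of `b`, and every admissible residue class has a number of comparable size with as many
generators. -/
theorem exists_small_of_minimal {b u m : ℕ} (hb : 2 ≤ b) (hF : 2 ≤ F b u)
    (hmin : ∀ u', F b u' = F b u → u ≤ u') (hm1 : b ^ m ≤ u) (hm2 : u < b ^ (m + 1)) :
    b ^ m < u ∧ ∀ j : ZMod (b - 1), ∃ u' : ℕ, F b u' = F b u ∧ (u' : ZMod (b - 1)) = 2 * j ∧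
      u' < b ^ (m + 1) ∧ (Odd b → 2 * u' < b ^ (m + 1)) := by
  obtain ⟨v₁, v₂, hv₁, hv₂, hne⟩ := (Set.one_lt_ncard_iff (finite_generators b u)).1 hF
  simp only [Set.mem_ofPred_eq] at hv₁ hv₂
  rcases Nat.lt_or_ge m 2 with hm | hm
  · have hu2 : u < b ^ 2 := hm2.trans_le (Nat.pow_le_pow_right (by omega) (by omega))
    obtain ⟨hodd, hbu⟩ : Odd b ∧ b < u := by
      have hle₁ : v₁ ≤ u := by unfold f at hv₁; omega
      have hle₂ : v₂ ≤ u := by unfold f at hv₂; omega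
      rcases hne.lt_or_gt with h | h
      · have := eq_of_f_eq_of_lt hb (by omega) h (hv₁.trans hv₂.symm)
        exact ⟨this.1, hv₂ ▸ this.2.2⟩
      · have := eq_of_f_eq_of_lt hb (by omega) h (hv₂.trans hv₁.symm)
        exact ⟨this.1, hv₁ ▸ this.2.2⟩
    have hm_one : m = 1 := by
      by_contra hcon
      obtain rfl : m = 0 := by omega
      simp at hm2
      omega
    subst hm_one
    refine ⟨by simpa using hbu, fun j => ?_⟩
    obtain ⟨d, hd1, hdb, hdo, hde⟩ := exists_digit_two_mul_eq hb j
    have h1 := hdo hodd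
    have h2 : 2 * (d * (b + 1)) < b ^ 2 := by
      obtain ⟨c, rfl⟩ : ∃ c, b = c + 1 := ⟨b - 1, by omega⟩
      rw [Nat.add_sub_cancel] at h1
      nlinarith
    refine ⟨d * (b + 1), ?_, ?_, show _ < b ^ 2 by omega, fun _ => h2⟩
    · rw [F_mul_succ hb hodd hd1 h1]
      exact le_antisymm hF (F_le_two hb hu2)
    · push_cast
      rw [natCast_base hb]
      linear_combination hde
  · have hlt := succ_mul_lt_pow hb hm
    rw [add_mul] at hlt
    have hpos : 0 < b ^ m := by omega
    obtain ⟨d, t, rfl, hd1, hdb, ht⟩ : ∃ d t, u = d * b ^ m + t ∧ 1 ≤ d ∧ d < b ∧ t < b ^ m :=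
      ⟨u / b ^ m, u % b ^ m, (Nat.div_add_mod' _ _).symm, Nat.div_pos hm1 hpos,
        Nat.div_lt_of_lt_mul (by rwa [← pow_succ]), Nat.mod_lt _ hpos⟩
    have hd : b ^ m ≤ d * b ^ m := Nat.le_mul_of_pos_left _ hd1
    have hsplit := F_mul_pow_add hb hm hd1 hdb ht
    have hdt : d ≤ t := by
      by_contra hcon
      have h1 : {w : ℕ | f b w + d = t} = ∅ := by
        refine Set.eq_empty_of_forall_notMem fun w hw => ?_
        simp only [Set.mem_ofPred_eq] at hw; omega
      have h2 : {x : ℕ | f b x + t + 2 = m * (b - 1) + d} =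
          {x : ℕ | f b x = m * (b - 1) + d - t - 2} := by
        have : 2 * 1 ≤ m * (b - 1) := Nat.mul_le_mul hm (by omega)
        ext w; simp only [Set.mem_ofPred_eq]; omega
      rw [h1, h2, Set.ncard_empty, zero_add] at hsplit
      have := hmin _ hsplit.symm
      omega
    obtain ⟨p, rfl⟩ := Nat.exists_eq_add_of_le hdt
    have hp : {w : ℕ | f b w + d = d + p} = {w : ℕ | f b w = p} := by
      ext w; simp only [Set.mem_ofPred_eq]; omega
    have hpm : p + 2 ≤ m * (b - 1) := by
      by_contra hcon
      have h1 : {x : ℕ | f b x + (d + p) + 2 = m * (b - 1) + d} = ∅ := by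
        refine Set.eq_empty_of_forall_notMem fun w hw => ?_
        simp only [Set.mem_ofPred_eq] at hw; omega
      rw [h1, hp, Set.ncard_empty, add_zero] at hsplit
      have := hmin _ hsplit.symm
      omega
    refine ⟨by omega, fun j => ?_⟩
    obtain ⟨q, hq⟩ := Nat.exists_eq_add_of_le hpm
    have hpq : p + q + 2 = m * (b - 1) := by omega
    rw [F_mul_pow_add_add hb hm hd1 hdb hpq]
    have hpz : (p : ZMod (b - 1)) = 2 * (v₁ - d) := by
      have h1 := natCast_f hb v₁
      rw [hv₁] at h1
      push_cast at h1
      rw [natCast_base hb] at h1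
      linear_combination h1
    rcases le_total p q with h | h
    · exact exists_small_of_split hb hm hpq h j _ hpz
    · have hqz : (q : ZMod (b - 1)) = 2 * (-1 - (v₁ - d)) := by
        have h1 := congrArg (Nat.cast : ℕ → ZMod (b - 1)) hpq
        rw [Nat.cast_mul, ZMod.natCast_self] at h1
        push_cast at h1
        linear_combination h1 - hpz
      rw [add_comm (F b p)]
      exact exists_small_of_split hb hm (by omega) h j _ hqz

theorem stmt14 (b : ℕ) (hb : 2 ≤ b) (i : ZMod (b - 1)) (hi : i ∈ I b) (n : ℕ) (hn : 2 ≤ n)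
    (hex : ∀ m, 1 ≤ m → ∀ j ∈ I b, ∃ u : ℕ, F b u = m ∧ (u : ZMod (b - 1)) = j) :
    b ^ B b n < K b n ∧ K b n ≤ Ki b i n ∧
    (Even b → Ki b i n < b ^ (B b n + 1)) ∧
    (Odd b → 2 * Ki b i n < b ^ (B b n + 1)) := by
  have hFi : F b (Ki b i n) = n := (Nat.sInf_mem (hex n (by omega) i hi)).1
  have hFK : F b (K b n) = n := Nat.sInf_mem (s := {u : ℕ | F b u = n}) ⟨_, hFi⟩
  have hmin : ∀ u', F b u' = n → K b n ≤ u' := fun u' h => Nat.sInf_le h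
  have hK0 : K b n ≠ 0 := by
    intro h
    rw [h, F_zero] at hFK
    omega
  obtain ⟨hlow, hup⟩ := exists_small_of_minimal (m := B b n) hb (hFK.symm ▸ hn)
    (hFK.symm ▸ hmin) (Nat.pow_log_le_self b hK0) (Nat.lt_pow_succ_log_self (by omega) _)
  obtain ⟨j, hj⟩ := exists_eq_two_mul_of_mem_I hb hi
  obtain ⟨u, hu, huz, hu1, hu2⟩ := hup j
  have hle : Ki b i n ≤ u := Nat.sInf_le ⟨hu.trans hFK, huz.trans hj.symm⟩
  refine ⟨hlow, hmin _ hFi, fun _ => by omega, fun ho => ?_⟩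
  have := hu2 ho
  omega

end Kaprekar
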